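/- arXiv:2304.00120 — 2 statements merged into one kernel-verified Lean document; each statement's English description precedes it below -/
import Mathlib

section
/- Let A ∈ ℤ^{m×n}, m < n, be an integral matrix of rank m. Then the system Ax = 0 has n-m linearly independent solutions x₁, …, x_{n-m} ∈ ℤⁿ with ∏_{i=1}^{n-m} ‖x_i‖_∞ ≤ √(det(AAᵀ))/gcd(A), where gcd(A) is the greatest common divisor of all m×m subdeterminants of A. -/
section

open MeasureTheory Set
open scoped ENNReal Pointwise

theorem volume_add_le_of_add_mem {A B C : Set ℝ} (hA : MeasurableSet A) (hB : MeasurableSet B)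
    (hA' : A.Nonempty) (hB' : B.Nonempty) (h : ∀ x ∈ A, ∀ y ∈ B, x + y ∈ C) :
    volume A + volume B ≤ volume C := by
  have key : ∀ K ⊆ A, IsCompact K → K.Nonempty → ∀ L ⊆ B, IsCompact L → L.Nonempty →
      volume K + volume L ≤ volume C := by
    intro K hKA hK hK' L hLB hL hL'
    obtain ⟨k, hkK, hk⟩ := hK.exists_isGreatest hK'
    obtain ⟨l, hlL, hl⟩ := hL.exists_isLeast hL'
    have h1 : volume ((fun x => x + l) '' K) = volume K := by
      simp
    have h2 : volume ((fun x => k + x) '' L) = volume L := by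
      simp
    have hm : MeasurableSet ((fun x => k + x) '' L) :=
      (hL.image (by fun_prop)).measurableSet
    have h3 : volume (((fun x => x + l) '' K) ∩ ((fun x => k + x) '' L)) = 0 := by
      refine measure_mono_null (t := {k + l}) ?_ (by simp)
      rintro _ ⟨⟨x, hx, rfl⟩, ⟨y, hy, hxy⟩⟩
      have := hk hx
      have := hl hy
      simp only [mem_singleton_iff] at *
      linarith
    rw [← h1, ← h2, ← measure_union_add_inter _ hm, h3, add_zero]
    refine measure_mono ?_
    rintro _ (⟨x, hx, rfl⟩ | ⟨y, hy, rfl⟩)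
    · exact h _ (hKA hx) _ (hLB hlL)
    · exact h _ (hKA hkK) _ (hLB hy)
  obtain ⟨a, ha⟩ := hA'
  obtain ⟨b, hb⟩ := hB'
  have key2 : ∀ K ⊆ A, IsCompact K → ∀ L ⊆ B, IsCompact L → volume K + volume L ≤ volume C := by
    intro K hKA hK L hLB hL
    refine (add_le_add (measure_mono (subset_insert a K)) (measure_mono (subset_insert b L))).trans
      (key _ (insert_subset ha hKA) (hK.insert a) (insert_nonempty _ _) _
        (insert_subset hb hLB) (hL.insert b) (insert_nonempty _ _))
  have hsup : ∀ S : Set ℝ, MeasurableSet S →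
      volume S = ⨆ K : {K : Set ℝ // K ⊆ S ∧ IsCompact K}, volume K.1 := by
    intro S hS
    rw [hS.measure_eq_iSup_isCompact]
    simp only [iSup_subtype, iSup_and]
  have (S : Set ℝ) : Nonempty {K : Set ℝ // K ⊆ S ∧ IsCompact K} :=
    ⟨⟨∅, empty_subset _, isCompact_empty⟩⟩
  rw [hsup A hA, hsup B hB, ENNReal.iSup_add]
  refine iSup_le fun K => ?_
  rw [ENNReal.add_iSup]
  exact iSup_le fun L => key2 K.1 K.2.1 K.2.2 L.1 L.2.1 L.2.2

theorem ENNReal.rpow_mul_rpow_le_add {a b : ℝ} (ha : 0 < a) (hb : 0 < b) (hab : a + b = 1)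
    (x y : ℝ≥0∞) : x ^ a * y ^ b ≤ ENNReal.ofReal a * x + ENNReal.ofReal b * y := by
  have hpq : (a⁻¹).HolderConjugate b⁻¹ := by
    rw [Real.holderConjugate_iff]
    refine ⟨(one_lt_inv₀ ha).2 (by linarith), by simpa using hab⟩
  refine (ENNReal.young_inequality _ _ hpq).trans_eq ?_
  rw [← ENNReal.rpow_mul, ← ENNReal.rpow_mul, mul_inv_cancel₀ ha.ne', mul_inv_cancel₀ hb.ne',
    ENNReal.rpow_one, ENNReal.rpow_one, ENNReal.ofReal_inv_of_pos ha, ENNReal.ofReal_inv_of_pos hb,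
    div_eq_mul_inv, div_eq_mul_inv, inv_inv, inv_inv, mul_comm x, mul_comm y]

theorem lintegral_add_le_of_sup_eq_one {a b : ℝ} (ha : 0 < a) (hb : 0 < b) (hab : a + b = 1)
    {f g h : ℝ → ℝ} (hf : Measurable f) (hg : Measurable g) (hh : Measurable h)
    (hf0 : 0 ≤ f) (hg0 : 0 ≤ g) (hh0 : 0 ≤ h) (hf1 : ∀ x, f x ≤ 1) (hg1 : ∀ x, g x ≤ 1)
    (hfs : ∀ t < 1, ∃ x, t < f x) (hgs : ∀ t < 1, ∃ x, t < g x)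
    (hfgh : ∀ x y, f x ^ a * g y ^ b ≤ h (a * x + b * y)) :
    ENNReal.ofReal a * (∫⁻ x, ENNReal.ofReal (f x)) + ENNReal.ofReal b * ∫⁻ x, ENNReal.ofReal (g x)
      ≤ ∫⁻ x, ENNReal.ofReal (h x) := by
  rw [lintegral_eq_lintegral_meas_lt _ (.of_forall hf0) hf.aemeasurable,
    lintegral_eq_lintegral_meas_lt _ (.of_forall hg0) hg.aemeasurable,
    lintegral_eq_lintegral_meas_lt _ (.of_forall hh0) hh.aemeasurable,
    ← lintegral_const_mul' _ _ ENNReal.ofReal_ne_top,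
    ← lintegral_const_mul' _ _ ENNReal.ofReal_ne_top,
    ← lintegral_add_left]
  · refine setLIntegral_mono' measurableSet_Ioi fun t ht => ?_
    have ht : 0 < t := ht
    rcases lt_or_ge t 1 with ht1 | ht1
    · have h1 : ∀ c : ℝ, 0 < c → ∀ s : Set ℝ, ENNReal.ofReal c * volume s = volume (c • s) := by
        intro c hc s
        rw [Measure.addHaar_smul]
        simp [abs_of_pos hc]
      rw [h1 a ha, h1 b hb]
      refine volume_add_le_of_add_mem ((measurableSet_lt measurable_const hf).const_smul₀ a)
        ((measurableSet_lt measurable_const hg).const_smul₀ b)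
        (Set.Nonempty.smul_set (hfs t ht1)) (Set.Nonempty.smul_set (hgs t ht1)) ?_
      rintro _ ⟨x, hx, rfl⟩ _ ⟨y, hy, rfl⟩
      refine lt_of_lt_of_le ?_ (hfgh x y)
      calc t = t ^ a * t ^ b := by rw [← Real.rpow_add ht, hab, Real.rpow_one]
        _ < f x ^ a * g y ^ b := by
          have := Real.rpow_lt_rpow ht.le hx ha
          have := Real.rpow_lt_rpow ht.le hy hb
          gcongr
    · have h1 : {x | t < f x} = ∅ := by
        ext x; simpa using (hf1 x).trans ht1
      have h2 : {x | t < g x} = ∅ := by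
        ext x; simpa using (hg1 x).trans ht1
      simp [h1, h2]
  · refine Measurable.const_mul ?_ _
    refine Antitone.measurable fun s t hst => measure_mono fun x hx => lt_of_le_of_lt hst hx

theorem prekopa_leindler_real_bounded {a b : ℝ} (ha : 0 < a) (hb : 0 < b) (hab : a + b = 1)
    {f g h : ℝ → ℝ≥0∞} (hf : Measurable f) (hg : Measurable g) (hh : Measurable h)
    {N : ℝ≥0∞} (hN : N ≠ ∞) (hfN : ∀ x, f x ≤ N) (hgN : ∀ x, g x ≤ N)
    (hfgh : ∀ x y, f x ^ a * g y ^ b ≤ h (a * x + b * y)) :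
    (∫⁻ x, f x) ^ a * (∫⁻ x, g x) ^ b ≤ ∫⁻ x, h x := by
  set α := ⨆ x, f x with hα
  set β := ⨆ x, g x with hβ
  have hαN : α ≠ ∞ := ((iSup_le hfN).trans_lt hN.lt_top).ne
  have hβN : β ≠ ∞ := ((iSup_le hgN).trans_lt hN.lt_top).ne
  by_cases hα0 : α = 0
  · have : ∀ x, f x = 0 := by simpa [hα] using hα0
    simp [this, ha]
  by_cases hβ0 : β = 0
  · have : ∀ x, g x = 0 := by simpa [hβ] using hβ0
    simp [this, hb]
  have hγ0 : α ^ a * β ^ b ≠ 0 := 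
    mul_ne_zero (ENNReal.rpow_pos (pos_iff_ne_zero.2 hα0) hαN).ne'
      (ENNReal.rpow_pos (pos_iff_ne_zero.2 hβ0) hβN).ne'
  have hγN : α ^ a * β ^ b ≠ ∞ := 
    ENNReal.mul_ne_top (ENNReal.rpow_ne_top_of_nonneg ha.le hαN)
      (ENNReal.rpow_ne_top_of_nonneg hb.le hβN)
  have hF1 : ∀ x, f x / α ≤ 1 := fun x => ENNReal.div_le_of_le_mul (by simpa using le_iSup f x)
  have hG1 : ∀ x, g x / β ≤ 1 := fun x => ENNReal.div_le_of_le_mul (by simpa using le_iSup g x)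
  have hsup : ∀ (u : ℝ → ℝ≥0∞), ⨆ x, u x ≠ 0 → ⨆ x, u x ≠ ∞ → (∀ x, u x / (⨆ x, u x) ≤ 1) →
      ∀ t < 1, ∃ x, t < (u x / ⨆ x, u x).toReal := by
    intro u hu0 huN hu1 t ht
    rcases lt_or_ge t 0 with h0 | h0
    · exact ⟨0, h0.trans_le ENNReal.toReal_nonneg⟩
    have : ENNReal.ofReal t * ⨆ x, u x < ⨆ x, u x := by
      conv_rhs => rw [← one_mul (⨆ x, u x)]
      exact ENNReal.mul_lt_mul_left hu0 huN (by simpa using ht)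
    obtain ⟨x, hx⟩ := lt_iSup_iff.1 this
    refine ⟨x, ?_⟩
    rw [← ENNReal.ofReal_lt_iff_lt_toReal h0 ((hu1 x).trans_lt ENNReal.one_lt_top).ne]
    rwa [ENNReal.lt_div_iff_mul_lt (.inl hu0) (.inl huN)]
  have key := lintegral_add_le_of_sup_eq_one ha hb hab (f := fun x => (f x / α).toReal)
    (g := fun x => (g x / β).toReal) (h := fun x => (min (h x / (α ^ a * β ^ b)) 1).toReal)
    (by fun_prop) (by fun_prop) (by fun_prop) (fun x => by positivity) (fun x => by positivity)
    (fun x => by positivity) (fun x => ENNReal.toReal_mono (by simp) (hF1 x)) 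
    (fun x => ENNReal.toReal_mono (by simp) (hG1 x)) (hsup f hα0 hαN hF1) (hsup g hβ0 hβN hG1) ?_
  · have e1 : ∀ x, ENNReal.ofReal (f x / α).toReal = f x * α⁻¹ := fun x =>
      ENNReal.ofReal_toReal ((hF1 x).trans_lt ENNReal.one_lt_top).ne
    have e2 : ∀ x, ENNReal.ofReal (g x / β).toReal = g x * β⁻¹ := fun x =>
      ENNReal.ofReal_toReal ((hG1 x).trans_lt ENNReal.one_lt_top).ne
    have e3 : ∀ x, ENNReal.ofReal (min (h x / (α ^ a * β ^ b)) 1).toReal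
        ≤ h x * (α ^ a * β ^ b)⁻¹ := fun x => ENNReal.ofReal_toReal_le.trans (min_le_left _ _)
    have := (ENNReal.rpow_mul_rpow_le_add ha hb hab _ _).trans (key.trans (lintegral_mono e3))
    simp only [e1, e2] at this
    rw [lintegral_mul_const _ hf, lintegral_mul_const _ hg, lintegral_mul_const _ hh,
      ENNReal.mul_rpow_of_nonneg _ _ ha.le, ENNReal.mul_rpow_of_nonneg _ _ hb.le, 
      mul_mul_mul_comm, ENNReal.inv_rpow, ENNReal.inv_rpow, 
      ← ENNReal.mul_inv (.inr (ENNReal.rpow_ne_top_of_nonneg hb.le hβN))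
        (.inl (ENNReal.rpow_ne_top_of_nonneg ha.le hαN))] at this
    exact (ENNReal.mul_le_mul_iff_left (by simpa using hγN) (by simpa using hγ0)).1 this
  · intro x y
    rw [ENNReal.toReal_rpow, ENNReal.toReal_rpow, ← ENNReal.toReal_mul]
    refine ENNReal.toReal_mono (by simp) (le_min ?_ ?_)
    · rw [div_eq_mul_inv, div_eq_mul_inv, ENNReal.mul_rpow_of_nonneg _ _ ha.le, 
        ENNReal.mul_rpow_of_nonneg _ _ hb.le, 
        mul_mul_mul_comm, ENNReal.inv_rpow, ENNReal.inv_rpow, 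
        ← ENNReal.mul_inv (.inr (ENNReal.rpow_ne_top_of_nonneg hb.le hβN))
        (.inl (ENNReal.rpow_ne_top_of_nonneg ha.le hαN)), div_eq_mul_inv]
      gcongr
      exact hfgh x y
    · exact mul_le_one' (ENNReal.rpow_le_one (hF1 x) ha.le) (ENNReal.rpow_le_one (hG1 y) hb.le)

theorem prekopa_leindler_real {a b : ℝ} (ha : 0 < a) (hb : 0 < b) (hab : a + b = 1)
    {f g h : ℝ → ℝ≥0∞} (hf : Measurable f) (hg : Measurable g) (hh : Measurable h)
    (hfgh : ∀ x y, f x ^ a * g y ^ b ≤ h (a * x + b * y)) :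
    (∫⁻ x, f x) ^ a * (∫⁻ x, g x) ^ b ≤ ∫⁻ x, h x := by
  have hlim : ∀ u : ℝ → ℝ≥0∞, Measurable u → Filter.Tendsto (fun n : ℕ => ∫⁻ x, min (u x) n)
      Filter.atTop (nhds (∫⁻ x, u x)) := by
    intro u hu
    refine lintegral_tendsto_of_tendsto_of_monotone (fun n => by fun_prop) ?_ ?_
    · exact .of_forall fun x m n hmn => min_le_min_left _ (by exact_mod_cast hmn)
    · refine .of_forall fun x => ?_
      have := (tendsto_const_nhds (x := u x)).min ENNReal.tendsto_nat_nhds_top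
      simpa using this
  have hbound : ∀ m n : ℕ, (∫⁻ x, min (f x) m) ^ a * (∫⁻ x, min (g x) n) ^ b ≤ ∫⁻ x, h x := by
    intro m n
    refine prekopa_leindler_real_bounded ha hb hab (by fun_prop) (by fun_prop) hh
      (N := max (m : ℝ≥0∞) n) (by simp) (fun x => (min_le_right _ _).trans (le_max_left _ _))
      (fun x => (min_le_right _ _).trans (le_max_right _ _)) fun x y => le_trans ?_ (hfgh x y)
    gcongr <;> exact min_le_left _ _
  have hmono : ∀ {c d : ℝ≥0∞}, c < ∫⁻ x, f x → d < ∫⁻ x, g x → c ^ a * d ^ b ≤ ∫⁻ x, h x := by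
    intro c d hc hd
    obtain ⟨m, hm⟩ := ((hlim f hf).eventually (lt_mem_nhds hc)).exists
    obtain ⟨n, hn⟩ := ((hlim g hg).eventually (lt_mem_nhds hd)).exists
    refine le_trans ?_ (hbound m n)
    gcongr
  refine ENNReal.mul_le_of_forall_lt fun c hc d hd => ?_
  have := hmono ((ENNReal.rpow_inv_lt_iff ha).2 hc) ((ENNReal.rpow_inv_lt_iff hb).2 hd)
  rwa [ENNReal.rpow_inv_rpow ha.ne', ENNReal.rpow_inv_rpow hb.ne'] at this

theorem lintegral_fin_succ {n : ℕ} {f : (Fin (n + 1) → ℝ) → ℝ≥0∞} (hf : Measurable f) :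
    ∫⁻ x, f x = ∫⁻ t : ℝ, ∫⁻ w : Fin n → ℝ, f (Fin.cons t w) := by
  have h := (volume_preserving_piFinSuccAbove (fun _ : Fin (n + 1) => ℝ) 0).symm
  rw [← h.lintegral_comp_emb (MeasurableEquiv.measurableEmbedding _), Measure.volume_eq_prod, lintegral_prod]
  · simp [MeasurableEquiv.piFinSuccAbove, Fin.consEquiv]
  · exact (hf.comp (MeasurableEquiv.measurable _)).aemeasurable

theorem measurable_fin_cons {n : ℕ} :
    Measurable fun p : ℝ × (Fin n → ℝ) => (Fin.cons p.1 p.2 : Fin (n + 1) → ℝ) := by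
  refine measurable_pi_lambda _ fun i => ?_
  refine Fin.cases ?_ (fun j => ?_) i
  · simpa using measurable_fst
  · simp only [Fin.cons_succ]
    fun_prop

theorem prekopa_leindler_pi {a b : ℝ} (ha : 0 < a) (hb : 0 < b) (hab : a + b = 1) {n : ℕ}
    {f g h : (Fin n → ℝ) → ℝ≥0∞} (hf : Measurable f) (hg : Measurable g) (hh : Measurable h)
    (hfgh : ∀ x y, f x ^ a * g y ^ b ≤ h (a • x + b • y)) :
    (∫⁻ x, f x) ^ a * (∫⁻ x, g x) ^ b ≤ ∫⁻ x, h x := by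
  induction n with
  | zero =>
    simp only [lintegral_unique, volume_pi, Measure.pi_univ, Finset.univ_eq_empty,
      Finset.prod_empty, mul_one]
    refine (hfgh _ _).trans_eq ?_
    congr 1
    exact Subsingleton.elim _ _
  | succ n ih =>
    rw [lintegral_fin_succ hf, lintegral_fin_succ hg, lintegral_fin_succ hh]
    have hF := hf.comp (measurable_fin_cons (n := n))
    have hG := hg.comp (measurable_fin_cons (n := n))
    have hH := hh.comp (measurable_fin_cons (n := n))
    refine prekopa_leindler_real ha hb hab hF.lintegral_prod_right' hG.lintegral_prod_right'
      hH.lintegral_prod_right' fun s t => ?_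
    refine ih (hF.comp measurable_prodMk_left) (hG.comp measurable_prodMk_left)
      (hH.comp measurable_prodMk_left) fun x y => ?_
    refine (hfgh _ _).trans_eq ?_
    congr 1
    ext i
    refine Fin.cases ?_ (fun j => ?_) i <;> simp

/-- Log-concavity of a function with values in the extended nonnegative reals. -/
def ENNRealLogConcave {E : Type*} [AddCommGroup E] [Module ℝ E] (f : E → ℝ≥0∞) : Prop :=
  ∀ ⦃a b : ℝ⦄, 0 < a → 0 < b → a + b = 1 → ∀ x y, f x ^ a * f y ^ b ≤ f (a • x + b • y)

namespace ENNRealLogConcave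

variable {E F : Type*} [AddCommGroup E] [Module ℝ E] [AddCommGroup F] [Module ℝ F]

theorem comp_linearMap {f : F → ℝ≥0∞} (hf : ENNRealLogConcave f) (l : E →ₗ[ℝ] F) :
    ENNRealLogConcave fun x => f (l x) := by
  intro a b ha hb hab x y
  simpa using hf ha hb hab (l x) (l y)

theorem finset_prod {ι : Type*} (s : Finset ι) {f : ι → E → ℝ≥0∞}
    (hf : ∀ i ∈ s, ENNRealLogConcave (f i)) : ENNRealLogConcave fun x => ∏ i ∈ s, f i x := by
  intro a b ha hb hab x y
  rw [← ENNReal.prod_rpow_of_nonneg ha.le, ← ENNReal.prod_rpow_of_nonneg hb.le,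
    ← Finset.prod_mul_distrib]
  exact Finset.prod_le_prod' fun i hi => hf i hi ha hb hab x y

theorem indicator_one {s : Set E} (hs : Convex ℝ s) :
    ENNRealLogConcave (s.indicator fun _ => (1 : ℝ≥0∞)) := by
  intro a b ha hb hab x y
  by_cases hx : x ∈ s
  · by_cases hy : y ∈ s
    · simp [hx, hy, hs hx hy ha.le hb.le hab]
    · simp [hy, hb]
  · simp [hx, ha]

end ENNRealLogConcave

/-- The Gaussian density `exp (-π t²)`. -/
noncomputable def stdGaussianDensity (t : ℝ) : ℝ≥0∞ := ENNReal.ofReal (Real.exp (-Real.pi * t ^ 2))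

theorem measurable_stdGaussianDensity : Measurable stdGaussianDensity := by
  unfold stdGaussianDensity
  fun_prop

theorem stdGaussianDensity_neg (t : ℝ) : stdGaussianDensity (-t) = stdGaussianDensity t := by
  simp [stdGaussianDensity]

theorem stdGaussianDensity_le_one (t : ℝ) : stdGaussianDensity t ≤ 1 := by
  rw [stdGaussianDensity, ENNReal.ofReal_le_one, Real.exp_le_one_iff]
  have := Real.pi_pos
  nlinarith [sq_nonneg t]

theorem lintegral_stdGaussianDensity : ∫⁻ t, stdGaussianDensity t = 1 := by
  unfold stdGaussianDensity
  rw [← ofReal_integral_eq_lintegral_ofReal (integrable_exp_neg_mul_sq Real.pi_pos)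
    (.of_forall fun t => (Real.exp_pos _).le), integral_gaussian]
  simp [Real.pi_ne_zero]

theorem ennrealLogConcave_stdGaussianDensity : ENNRealLogConcave stdGaussianDensity := by
  intro a b ha hb hab x y
  unfold stdGaussianDensity
  rw [ENNReal.ofReal_rpow_of_nonneg (Real.exp_pos _).le ha.le,
    ENNReal.ofReal_rpow_of_nonneg (Real.exp_pos _).le hb.le,
    ← ENNReal.ofReal_mul (by positivity), ← Real.exp_mul, ← Real.exp_mul, ← Real.exp_add]
  refine ENNReal.ofReal_le_ofReal (Real.exp_le_exp.2 ?_)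
  have hb' : b = 1 - a := by linarith
  have h1 : 0 ≤ Real.pi * (a * b * (x - y) ^ 2) := by positivity
  subst hb'
  simp only [smul_eq_mul]
  nlinarith

theorem lintegral_mul_stdGaussianDensity_le {F : ℝ → ℝ≥0∞} (hF : Measurable F)
    (heven : ∀ t, F (-t) = F t) (hanti : AntitoneOn F (Ici 0)) :
    ∫⁻ t, F t * stdGaussianDensity t ≤
      ∫⁻ t, F t * (Ioo (-1 / 2 : ℝ) (1 / 2)).indicator (fun _ => 1) t := by
  have habs : ∀ t, F |t| = F t := fun t => by
    rcases abs_choice t with h | h <;> rw [h]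
    exact heven t
  set S := Ioo (-1 / 2 : ℝ) (1 / 2) with hS
  have hSm : MeasurableSet S := measurableSet_Ioo
  have hφ := measurable_stdGaussianDensity
  set c := F (1 / 2) with hc
  have hin : ∀ t ∈ S, c ≤ F t := fun t ht => by
    rw [← habs t]
    refine hanti (abs_nonneg t) (by norm_num) (abs_le.2 ⟨?_, ht.2.le⟩)
    linarith [ht.1]
  have hout : ∀ t ∈ Sᶜ, F t ≤ c := fun t ht => by
    rw [← habs t]
    refine hanti (by norm_num) (abs_nonneg t) ?_
    by_contra! h
    have := abs_lt.1 h
    exact ht ⟨by linarith, this.2⟩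
  have hmass : ∫⁻ t in Sᶜ, stdGaussianDensity t = ∫⁻ t in S, (1 - stdGaussianDensity t) := by
    have h1 : (∫⁻ t in S, stdGaussianDensity t) + ∫⁻ t in Sᶜ, stdGaussianDensity t = 1 := by
      rw [lintegral_add_compl _ hSm, lintegral_stdGaussianDensity]
    have h2 : (∫⁻ t in S, stdGaussianDensity t) + ∫⁻ t in S, (1 - stdGaussianDensity t) = 1 := by
      rw [← lintegral_add_left hφ]
      simp only [add_tsub_cancel_of_le (stdGaussianDensity_le_one _)]
      simp [hS]
      norm_num
    have h3 : (∫⁻ t in S, stdGaussianDensity t) ≠ ∞ := by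
      intro h
      simp [h] at h1
    exact (ENNReal.add_right_inj h3).1 (h1.trans h2.symm)
  calc ∫⁻ t, F t * stdGaussianDensity t
      = (∫⁻ t in S, F t * stdGaussianDensity t) + ∫⁻ t in Sᶜ, F t * stdGaussianDensity t :=
        (lintegral_add_compl _ hSm).symm
    _ ≤ (∫⁻ t in S, F t * stdGaussianDensity t) + ∫⁻ t in Sᶜ, c * stdGaussianDensity t := by
        gcongr 1
        refine setLIntegral_mono' hSm.compl fun t ht => ?_
        gcongr
        exact hout t ht
    _ = (∫⁻ t in S, F t * stdGaussianDensity t) + ∫⁻ t in S, c * (1 - stdGaussianDensity t) := by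
        rw [lintegral_const_mul _ hφ, hmass, lintegral_const_mul _ (by fun_prop)]
    _ ≤ (∫⁻ t in S, F t * stdGaussianDensity t) + ∫⁻ t in S, F t * (1 - stdGaussianDensity t) := by
        gcongr 1
        refine setLIntegral_mono' hSm fun t ht => ?_
        gcongr
        exact hin t ht
    _ = ∫⁻ t in S, F t := by
        rw [← lintegral_add_left (by fun_prop)]
        simp only [← mul_add, add_tsub_cancel_of_le (stdGaussianDensity_le_one _), mul_one]
    _ = ∫⁻ t, F t * S.indicator (fun _ => 1) t := by
        rw [← lintegral_indicator hSm]
        congr 1 with t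
        by_cases ht : t ∈ S <;> simp [ht]

theorem ENNRealLogConcave.antitoneOn_marginal {n : ℕ} {g : (Fin (n + 1) → ℝ) → ℝ≥0∞}
    (hg : Measurable g) (hlc : ENNRealLogConcave g) (heven : ∀ x, g (-x) = g x) :
    (∀ t : ℝ, ∫⁻ w : Fin n → ℝ, g (Fin.cons (-t) w) = ∫⁻ w : Fin n → ℝ, g (Fin.cons t w)) ∧
      AntitoneOn (fun t : ℝ => ∫⁻ w : Fin n → ℝ, g (Fin.cons t w)) (Ici 0) := by
  have hev : ∀ t : ℝ, ∫⁻ w : Fin n → ℝ, g (Fin.cons (-t) w)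
      = ∫⁻ w : Fin n → ℝ, g (Fin.cons t w) := by
    intro t
    rw [← lintegral_neg_eq_self]
    congr 1 with w
    rw [← heven]
    congr 1
    ext i
    refine Fin.cases ?_ (fun j => ?_) i <;> simp
  refine ⟨hev, fun s hs t ht hst => ?_⟩
  rcases hst.eq_or_lt with rfl | hlt
  · rfl
  have hs : 0 ≤ s := hs
  have ht0 : 0 < t := hs.trans_lt hlt
  have ha : 0 < (1 + s / t) / 2 := by positivity
  have hb : 0 < (1 - s / t) / 2 := by
    have := (div_lt_one ht0).2 hlt
    linarith
  have hab : (1 + s / t) / 2 + (1 - s / t) / 2 = 1 := by ring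
  have hgm : ∀ t : ℝ, Measurable fun w : Fin n → ℝ => g (Fin.cons t w) := fun t =>
    (hg.comp measurable_fin_cons).comp measurable_prodMk_left
  have key := prekopa_leindler_pi ha hb hab (hgm t) (hgm (-t)) (hgm s) fun x y => by
    refine (hlc ha hb hab _ _).trans_eq ?_
    congr 1
    ext i
    refine Fin.cases ?_ (fun j => ?_) i
    · simp
      field_simp
      ring
    · simp
  rw [hev] at key
  rwa [← ENNReal.rpow_add_of_nonneg _ _ ha.le hb.le, hab, ENNReal.rpow_one] at key

theorem lintegral_comp_mulVec {k : ℕ} {M : Matrix (Fin k) (Fin k) ℝ} (hM : M.det ≠ 0)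
    {f : (Fin k → ℝ) → ℝ≥0∞} (hf : Measurable f) :
    ∫⁻ y, f (M.mulVec y) = ENNReal.ofReal |M.det⁻¹| * ∫⁻ y, f y := by
  have h := Real.map_matrix_volume_pi_eq_smul_volume_pi hM
  have hm : Measurable (Matrix.toLin' M) := (LinearMap.continuous_of_finiteDimensional _).measurable
  rw [← smul_eq_mul, ← lintegral_smul_measure, ← h, lintegral_map hf hm]
  simp

theorem exists_det_ne_zero_dotProduct_mulVec {k : ℕ} {c : Fin (k + 1) → ℝ} (hc : c ≠ 0) :
    ∃ M : Matrix (Fin (k + 1)) (Fin (k + 1)) ℝ, M.det ≠ 0 ∧ ∀ y, c ⬝ᵥ M.mulVec y = y 0 := by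
  obtain ⟨A, hA⟩ := SeparatingDual.exists_continuousLinearEquiv_apply_eq (R := ℝ) hc
    (y := (Pi.single 0 1 : Fin (k + 1) → ℝ)) (by simp)
  refine ⟨(LinearMap.toMatrix' (A.toLinearEquiv : (Fin (k + 1) → ℝ) →ₗ[ℝ] _)).transpose, ?_, ?_⟩
  · rw [Matrix.det_transpose, LinearMap.det_toMatrix']
    exact A.toLinearEquiv.isUnit_det'.ne_zero
  · intro y
    rw [Matrix.dotProduct_mulVec, Matrix.vecMul_transpose, LinearMap.toMatrix'_mulVec]
    simp [hA]

theorem lintegral_mul_stdGaussianDensity_dotProduct_le {k : ℕ} {g : (Fin k → ℝ) → ℝ≥0∞}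
    (hg : Measurable g) (hlc : ENNRealLogConcave g) (heven : ∀ x, g (-x) = g x)
    (c : Fin k → ℝ) :
    ∫⁻ y, g y * stdGaussianDensity (c ⬝ᵥ y) ≤
      ∫⁻ y, g y * (Ioo (-1 / 2 : ℝ) (1 / 2)).indicator (fun _ => 1) (c ⬝ᵥ y) := by
  by_cases hc : c = 0
  · subst hc
    have : (0 : ℝ) ∈ Ioo (-1 / 2 : ℝ) (1 / 2) := by norm_num
    simp only [zero_dotProduct, indicator_of_mem this]
    simp [stdGaussianDensity]
  cases k with
  | zero => exact absurd (Subsingleton.elim _ _) hc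
  | succ k =>
  obtain ⟨M, hM, hMc⟩ := exists_det_ne_zero_dotProduct_mulVec hc
  have hcm : Measurable fun y : Fin (k + 1) → ℝ => c ⬝ᵥ y := by
    unfold dotProduct
    fun_prop
  have hφ := measurable_stdGaussianDensity
  have hI : Measurable ((Ioo (-1 / 2 : ℝ) (1 / 2)).indicator fun _ => (1 : ℝ≥0∞)) :=
    measurable_const.indicator measurableSet_Ioo
  have hpos : ENNReal.ofReal |M.det⁻¹| ≠ 0 := by simpa using hM
  rw [← ENNReal.mul_le_mul_iff_right hpos ENNReal.ofReal_ne_top,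
    ← lintegral_comp_mulVec hM (f := fun y => g y * stdGaussianDensity (c ⬝ᵥ y))
      (hg.mul (hφ.comp hcm)),
    ← lintegral_comp_mulVec hM (f := fun y => g y * (Ioo (-1 / 2 : ℝ) (1 / 2)).indicator (fun _ => 1) (c ⬝ᵥ y))
      (hg.mul (hI.comp hcm))]
  have hMm : Measurable fun y => M.mulVec y :=
    (LinearMap.continuous_of_finiteDimensional (Matrix.toLin' M)).measurable
  have hg' : Measurable fun y => g (M.mulVec y) := hg.comp hMm
  have hp0 : Measurable fun y : Fin (k + 1) → ℝ => y 0 := measurable_pi_apply 0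
  simp only [hMc]
  rw [lintegral_fin_succ (f := fun y => g (M.mulVec y) * stdGaussianDensity (y 0))
      (hg'.mul (hφ.comp hp0)),
    lintegral_fin_succ
      (f := fun y => g (M.mulVec y) * (Ioo (-1 / 2 : ℝ) (1 / 2)).indicator (fun _ => 1) (y 0))
      (hg'.mul (hI.comp hp0))]
  have hgc : ∀ t : ℝ, Measurable fun w : Fin k → ℝ => g (M.mulVec (Fin.cons t w)) := fun t =>
    (hg'.comp measurable_fin_cons).comp measurable_prodMk_left
  simp only [Fin.cons_zero, lintegral_mul_const _ (hgc _)]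
  obtain ⟨h1, h2⟩ := ENNRealLogConcave.antitoneOn_marginal hg'
    (hlc.comp_linearMap (Matrix.toLin' M)) (fun x => by rw [Matrix.mulVec_neg, heven])
  exact lintegral_mul_stdGaussianDensity_le
    ((hg'.comp measurable_fin_cons).lintegral_prod_right') h1 h2

/-- The Gaussian integral over a subspace parametrised by `B` is at most the volume of the
corresponding section of the unit cube. -/
theorem lintegral_prod_stdGaussianDensity_le_volume {k : ℕ} {ι : Type*} [Fintype ι]
    (B : Matrix ι (Fin k) ℝ) :
    ∫⁻ y, ∏ i, stdGaussianDensity (B i ⬝ᵥ y) ≤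
      volume {y : Fin k → ℝ | ∀ i, B i ⬝ᵥ y ∈ Ioo (-1 / 2 : ℝ) (1 / 2)} := by
  classical
  set I : ℝ → ℝ≥0∞ := (Ioo (-1 / 2 : ℝ) (1 / 2)).indicator fun _ => (1 : ℝ≥0∞) with hIdef
  have hφ := measurable_stdGaussianDensity
  have hI : Measurable I := measurable_const.indicator measurableSet_Ioo
  have hIneg : ∀ t, I (-t) = I t := by
    intro t
    have : -t ∈ Ioo (-1 / 2 : ℝ) (1 / 2) ↔ t ∈ Ioo (-1 / 2 : ℝ) (1 / 2) := by
      constructor <;> rintro ⟨h1, h2⟩ <;> constructor <;> linarith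
    by_cases h : t ∈ Ioo (-1 / 2 : ℝ) (1 / 2)
    · rw [hIdef, indicator_of_mem h, indicator_of_mem (this.2 h)]
    · rw [hIdef, indicator_of_notMem h, indicator_of_notMem (mt this.1 h)]
  have hcm : ∀ i, Measurable fun y : Fin k → ℝ => B i ⬝ᵥ y := fun i => by
    unfold dotProduct
    fun_prop
  let Φ : Finset ι → ι → (Fin k → ℝ) → ℝ≥0∞ := fun s i y =>
    if i ∈ s then I (B i ⬝ᵥ y) else stdGaussianDensity (B i ⬝ᵥ y)
  have hlin : ∀ i, ∃ l : (Fin k → ℝ) →ₗ[ℝ] ℝ, ∀ y, l y = B i ⬝ᵥ y := fun i =>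
    ⟨(LinearMap.proj i).comp (Matrix.toLin' B), fun y => rfl⟩
  have hΦm : ∀ s i, Measurable (Φ s i) := fun s i => by
    by_cases h : i ∈ s
    · simp only [Φ, h, if_true]
      exact hI.comp (hcm i)
    · simp only [Φ, h, if_false]
      exact hφ.comp (hcm i)
  have hΦc : ∀ s i, ENNRealLogConcave (Φ s i) := fun s i => by
    obtain ⟨l, hl⟩ := hlin i
    by_cases h : i ∈ s
    · simpa only [Φ, h, if_true, hl] using
        (ENNRealLogConcave.indicator_one (convex_Ioo (-1 / 2 : ℝ) (1 / 2))).comp_linearMap l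
    · simpa only [Φ, h, if_false, hl] using ennrealLogConcave_stdGaussianDensity.comp_linearMap l
  have hΦe : ∀ s i y, Φ s i (-y) = Φ s i y := fun s i y => by
    simp only [Φ, dotProduct_neg, hIneg, stdGaussianDensity_neg]
  have key : ∀ s : Finset ι, ∫⁻ y, ∏ i, Φ ∅ i y ≤ ∫⁻ y, ∏ i, Φ s i y := by
    intro s
    induction s using Finset.induction_on with
    | empty => exact le_rfl
    | insert j s hj ih =>
      refine ih.trans ?_
      have h1 : ∀ y, ∏ i, Φ s i y =
          (∏ i ∈ Finset.univ.erase j, Φ s i y) * stdGaussianDensity (B j ⬝ᵥ y) := fun y => by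
        rw [← Finset.prod_erase_mul _ _ (Finset.mem_univ j)]
        simp only [Φ, hj, if_false]
      have h2 : ∀ y, ∏ i, Φ (insert j s) i y =
          (∏ i ∈ Finset.univ.erase j, Φ s i y) * I (B j ⬝ᵥ y) := fun y => by
        rw [← Finset.prod_erase_mul _ _ (Finset.mem_univ j)]
        congr 1
        · refine Finset.prod_congr rfl fun i hi => ?_
          simp only [Φ, Finset.mem_insert, Finset.ne_of_mem_erase hi, false_or]
        · simp [Φ]
      simp only [h1, h2]
      refine lintegral_mul_stdGaussianDensity_dotProduct_le
        (Finset.measurable_prod _ fun i _ => hΦm s i)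
        (ENNRealLogConcave.finset_prod _ fun i _ => hΦc s i) (fun y => ?_) (B j)
      simp only [hΦe]
  have hfin := key Finset.univ
  simp only [Φ, Finset.notMem_empty, if_false, Finset.mem_univ, if_true] at hfin
  refine hfin.trans_eq ?_
  have hset : MeasurableSet {y : Fin k → ℝ | ∀ i, B i ⬝ᵥ y ∈ Ioo (-1 / 2 : ℝ) (1 / 2)} := by
    rw [ofPred_forall]
    exact MeasurableSet.iInter fun i => hcm i measurableSet_Ioo
  rw [← lintegral_indicator_one hset]
  congr 1 with y
  by_cases hy : ∀ i, B i ⬝ᵥ y ∈ Ioo (-1 / 2 : ℝ) (1 / 2)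
  · rw [indicator_of_mem (by exact hy)]
    exact Finset.prod_eq_one fun i _ => indicator_of_mem (hy i) _
  · rw [indicator_of_notMem (by exact hy)]
    push Not at hy
    obtain ⟨i, hi⟩ := hy
    exact Finset.prod_eq_zero (Finset.mem_univ i) (indicator_of_notMem hi _)

theorem lintegral_prod_stdGaussianDensity_apply (k : ℕ) :
    ∫⁻ y : Fin k → ℝ, ∏ i, stdGaussianDensity (y i) = 1 := by
  induction k with
  | zero => simp [lintegral_unique, volume_pi]
  | succ k ih =>
    have hφ := measurable_stdGaussianDensity
    rw [lintegral_fin_succ (by fun_prop)]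
    simp only [Fin.prod_univ_succ, Fin.cons_zero, Fin.cons_succ]
    simp only [lintegral_const_mul' _ _ (ne_top_of_le_ne_top ENNReal.one_ne_top
      (stdGaussianDensity_le_one _)), ih, mul_one, lintegral_stdGaussianDensity]

theorem prod_stdGaussianDensity_mulVec {ι : Type*} [Fintype ι] {k : ℕ} (B : Matrix ι (Fin k) ℝ)
    (y : Fin k → ℝ) : ∏ i, stdGaussianDensity (B i ⬝ᵥ y) =
      ENNReal.ofReal (Real.exp (-Real.pi * (y ⬝ᵥ (B.transpose * B).mulVec y))) := by
  unfold stdGaussianDensity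
  rw [← ENNReal.ofReal_prod_of_nonneg (fun i _ => (Real.exp_pos _).le), ← Real.exp_sum,
    ← Finset.mul_sum, ← Matrix.mulVec_mulVec, Matrix.dotProduct_mulVec, Matrix.vecMul_transpose]
  simp only [dotProduct, Matrix.mulVec, sq]

open scoped MatrixOrder Matrix.Norms.L2Operator in
/-- **Vaaler's cube slicing inequality**, for a parametrised central section of the unit cube. -/
theorem inv_sqrt_det_le_volume_section {k : ℕ} {ι : Type*} [Fintype ι]
    (B : Matrix ι (Fin k) ℝ) (hB : (B.transpose * B).det ≠ 0) :
    ENNReal.ofReal (√(B.transpose * B).det)⁻¹ ≤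
      volume {y : Fin k → ℝ | ∀ i, B i ⬝ᵥ y ∈ Ioo (-1 / 2 : ℝ) (1 / 2)} := by
  refine le_trans (le_of_eq ?_) (lintegral_prod_stdGaussianDensity_le_volume B)
  obtain ⟨S, hS⟩ : ∃ S : Matrix (Fin k) (Fin k) ℝ, B.transpose * B = S.transpose * S := by
    have hpsd : (B.transpose * B).PosSemidef := by
      simpa using Matrix.posSemidef_conjTranspose_mul_self B
    obtain ⟨S, hS⟩ := CStarAlgebra.nonneg_iff_eq_star_mul_self.1
      (Matrix.nonneg_iff_posSemidef.2 hpsd)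
    exact ⟨S, by simpa [Matrix.star_eq_conjTranspose] using hS⟩
  have hdet : (B.transpose * B).det = S.det ^ 2 := by
    rw [hS, Matrix.det_mul, Matrix.det_transpose, sq]
  have hS0 : S.det ≠ 0 := by
    intro h
    simp [hdet, h] at hB
  have hφ := measurable_stdGaussianDensity
  have h1 : ∀ y, ∏ i, stdGaussianDensity (B i ⬝ᵥ y) = ∏ i, stdGaussianDensity (S.mulVec y i) := by
    intro y
    rw [prod_stdGaussianDensity_mulVec, hS, ← prod_stdGaussianDensity_mulVec]
    rfl
  simp only [h1]
  rw [lintegral_comp_mulVec hS0 (f := fun y => ∏ i, stdGaussianDensity (y i)) (by fun_prop),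
    lintegral_prod_stdGaussianDensity_apply, mul_one, hdet, Real.sqrt_sq_eq_abs, abs_inv]

theorem exists_measurable_section {V W : Type*} [TopologicalSpace V] [TopologicalSpace.SeparableSpace V] [Nonempty V]
    [MeasurableSpace V] [TopologicalSpace W] [MeasurableSpace W] [OpensMeasurableSpace W]
    {K : Set (V × W)} (hK : IsOpen K) :
    ∃ s : W → V, Measurable s ∧ ∀ x w, (x, w) ∈ K → (s w, w) ∈ K := by
  classical
  let p : W → ℕ → Prop := fun w n => (TopologicalSpace.denseSeq V n, w) ∈ K ∨ ¬ ∃ m, (TopologicalSpace.denseSeq V m, w) ∈ K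
  have hp : ∀ w, ∃ n, p w n := fun w => by
    by_cases h : ∃ m, (TopologicalSpace.denseSeq V m, w) ∈ K
    · obtain ⟨m, hm⟩ := h
      exact ⟨m, Or.inl hm⟩
    · exact ⟨0, Or.inr h⟩
  have hopen : ∀ n, MeasurableSet {w | (TopologicalSpace.denseSeq V n, w) ∈ K} := fun n =>
    (hK.preimage (by fun_prop : Continuous fun w : W => (TopologicalSpace.denseSeq V n, w))).measurableSet
  have hpm : ∀ n, MeasurableSet {w | p w n} := fun n => by
    refine (hopen n).union (MeasurableSet.compl ?_)
    have : {w | ∃ m, (TopologicalSpace.denseSeq V m, w) ∈ K} = ⋃ m, {w | (TopologicalSpace.denseSeq V m, w) ∈ K} := by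
      ext; simp
    have h := MeasurableSet.iUnion hopen
    rw [← this] at h
    exact h
  refine ⟨fun w => TopologicalSpace.denseSeq V (Nat.find (hp w)),
    (measurable_from_top (f := TopologicalSpace.denseSeq V)).comp (measurable_find hp hpm), fun x w hxw => ?_⟩
  rcases Nat.find_spec (hp w) with h | h
  · exact h
  · exfalso
    apply h
    have ho : IsOpen {x | (x, w) ∈ K} := hK.preimage (by fun_prop)
    obtain ⟨m, hm⟩ := (TopologicalSpace.denseRange_denseSeq V).exists_mem_open ho ⟨x, hxw⟩
    exact ⟨m, hm⟩

theorem exists_squeeze_prod {V W : Type*} [NormedAddCommGroup V] [NormedSpace ℝ V]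
    [FiniteDimensional ℝ V] [MeasurableSpace V] [BorelSpace V] [NormedAddCommGroup W]
    [NormedSpace ℝ W] [MeasurableSpace W] [BorelSpace W] (μ : Measure V)
    [μ.IsAddHaarMeasure] (ν : Measure W) [SFinite ν] {K A : Set (V × W)} (hK : IsOpen K)
    (hKc : Convex ℝ K) (hA : MeasurableSet A) (hAK : A ⊆ K) {θ : ℝ} (h0 : 0 < θ) (h1 : θ ≤ 1) :
    ∃ A' ⊆ K, MeasurableSet A' ∧
      μ.prod ν A' = ENNReal.ofReal (θ ^ Module.finrank ℝ V) * μ.prod ν A ∧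
      ∀ a ∈ A', ∀ b ∈ A', a.2 = b.2 → ∃ a₁ ∈ A, ∃ b₁ ∈ A, a - b = θ • (a₁ - b₁) := by
  obtain ⟨s, hs, hsK⟩ := exists_measurable_section hK
  have : TopologicalSpace.SeparableSpace V := inferInstance
  let Ψ : V × W → V × W := fun p => (θ⁻¹ • (p.1 - (1 - θ) • s p.2), p.2)
  have hΨ : Measurable Ψ := by fun_prop
  refine ⟨Ψ ⁻¹' A, ?_, hΨ hA, ?_, ?_⟩
  · rintro ⟨x, w⟩ h
    have h2 := hAK h
    have h3 := hKc h2 (hsK _ _ h2) h0.le (by linarith : 0 ≤ 1 - θ) (by ring)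
    convert h3 using 1
    ext <;> simp [Ψ, smul_smul, h0.ne', ← add_smul]
  · rw [Measure.prod_apply_symm hA, Measure.prod_apply_symm (hΨ hA),
      ← lintegral_const_mul' _ _ ENNReal.ofReal_ne_top]
    congr 1 with w
    have : (fun x => (x, w)) ⁻¹' (Ψ ⁻¹' A) =
        (fun x => x - (1 - θ) • s w) ⁻¹' ((θ⁻¹ • ·) ⁻¹' ((fun x => (x, w)) ⁻¹' A)) := rfl
    simp only [sub_eq_add_neg] at this
    rw [this, measure_preimage_add_right, Measure.addHaar_preimage_smul _ (inv_ne_zero h0.ne')]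
    congr 2
    rw [inv_pow, inv_inv, abs_of_pos (by positivity)]
  · rintro ⟨x, w⟩ ha ⟨y, w'⟩ hb (rfl : w = w')
    refine ⟨_, ha, _, hb, ?_⟩
    ext
    · simp [Ψ, ← smul_sub, smul_smul, h0.ne']
    · simp [Ψ]

theorem exists_squeeze {E : Type*} [NormedAddCommGroup E] [NormedSpace ℝ E]
    [FiniteDimensional ℝ E] [MeasurableSpace E] [BorelSpace E] (μ : Measure E)
    [μ.IsAddHaarMeasure] (V : Submodule ℝ E) {K A : Set E} (hK : IsOpen K)
    (hKc : Convex ℝ K) (hA : MeasurableSet A) (hAK : A ⊆ K) {θ : ℝ} (h0 : 0 < θ) (h1 : θ ≤ 1) :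
    ∃ A' ⊆ K, MeasurableSet A' ∧
      μ A' = ENNReal.ofReal (θ ^ Module.finrank ℝ V) * μ A ∧
      ∀ a ∈ A', ∀ b ∈ A', a - b ∈ V → ∃ a₁ ∈ A, ∃ b₁ ∈ A, a - b = θ • (a₁ - b₁) := by
  obtain ⟨W, hW⟩ := V.exists_isCompl
  let e : (V × W) ≃L[ℝ] E := (Submodule.prodEquivOfIsCompl V W hW).toContinuousLinearEquiv
  let ρ : Measure (V × W) := Measure.addHaar.prod Measure.addHaar
  have hem : Measurable e := e.continuous.measurable
  have hem' : Measurable e.symm := e.symm.continuous.measurable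
  have hμ : ∃ c : ℝ≥0∞, ∀ S : Set E, MeasurableSet S → μ S = c * ρ (e ⁻¹' S) := by
    have : (ρ.map e).IsAddHaarMeasure := e.isAddHaarMeasure_map ρ
    refine ⟨((Measure.addHaarScalarFactor μ (ρ.map e) : NNReal) : ℝ≥0∞), fun S hS => ?_⟩
    rw [← Measure.map_apply hem hS]
    exact congrArg (· S) (Measure.isAddLeftInvariant_eq_smul μ (ρ.map e))
  obtain ⟨c, hc⟩ := hμ
  obtain ⟨A', hA'K, hA'm, hA'v, hA'd⟩ := exists_squeeze_prod (Measure.addHaar (G := V))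
    (Measure.addHaar (G := W)) (hK.preimage e.continuous)
    (hKc.linear_preimage (e.toLinearEquiv : (V × W) →ₗ[ℝ] E)) (hem hA) (preimage_mono hAK) h0 h1
  refine ⟨e.symm ⁻¹' A', ?_, hem' hA'm, ?_, ?_⟩
  · intro x hx
    simpa using hA'K hx
  · rw [hc _ (hem' hA'm), hc _ hA, ← preimage_comp]
    simp only [ContinuousLinearEquiv.symm_comp_self, preimage_id]
    rw [hA'v]
    exact mul_left_comm _ _ _
  · intro a ha b hb hab
    obtain ⟨a₁, ha₁, b₁, hb₁, h⟩ := hA'd _ ha _ hb (by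
      rw [← sub_eq_zero, ← Prod.snd_sub, ← map_sub]
      exact (Submodule.prodEquivOfIsCompl_symm_apply_snd_eq_zero V W hW).2 hab)
    refine ⟨e a₁, ha₁, e b₁, hb₁, ?_⟩
    apply e.symm.injective
    simpa using h

theorem exists_sub_eq_intCast {k : ℕ} {A : Set (Fin k → ℝ)} (hA : MeasurableSet A)
    (h : 1 < volume A) :
    ∃ a ∈ A, ∃ b ∈ A, ∃ x : Fin k → ℤ, x ≠ 0 ∧ a - b = fun i => (x i : ℝ) := by
  have hF := ZSpan.isAddFundamentalDomain (Pi.basisFun ℝ (Fin k)) volume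
  have : Countable (Submodule.span ℤ (range (Pi.basisFun ℝ (Fin k)))).toAddSubgroup :=
    inferInstanceAs (Countable (Submodule.span ℤ (range (Pi.basisFun ℝ (Fin k)))))
  have hF1 : volume (ZSpan.fundamentalDomain (Pi.basisFun ℝ (Fin k))) = 1 := by
    rw [ZSpan.fundamentalDomain_pi_basisFun, volume_pi_pi]
    simp
  obtain ⟨x, y, hxy, hd⟩ := exists_pair_mem_lattice_not_disjoint_vadd
    (L := (Submodule.span ℤ (range (Pi.basisFun ℝ (Fin k)))).toAddSubgroup)
    hF hA.nullMeasurableSet (hF1 ▸ h)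
  obtain ⟨z, ⟨a, ha, hza⟩, ⟨b, hb, hzb⟩⟩ := Set.not_disjoint_iff.1 hd
  have hmem : ((y - x : (Submodule.span ℤ (range (Pi.basisFun ℝ (Fin k)))).toAddSubgroup) :
      Fin k → ℝ) ∈ Submodule.span ℤ (range (Pi.basisFun ℝ (Fin k))) := (y - x).2
  rw [Module.Basis.mem_span_iff_repr_mem] at hmem
  choose v hv using hmem
  have hab : a - b = fun i => (v i : ℝ) := by
    ext i
    have h1 := hv i
    simp only [Pi.basisFun_repr] at h1
    have h2 : (x : Fin k → ℝ) + a = y + b := hza.trans hzb.symm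
    have h3 : a - b = y - x := by
      rw [sub_eq_sub_iff_add_eq_add, add_comm, h2]
    rw [h3]
    simpa using h1.symm
  refine ⟨a, ha, b, hb, v, ?_, hab⟩
  rintro rfl
  apply hxy
  have h2 : (x : Fin k → ℝ) + a = y + b := hza.trans hzb.symm
  have h4 : a = b := by
    rw [← sub_eq_zero, hab]
    ext; simp
  rw [h4] at h2
  exact Subtype.ext (add_right_cancel h2)

theorem Seminorm.exists_subset_ball_sub_lt {E : Type*} [NormedAddCommGroup E] [NormedSpace ℝ E]
    [FiniteDimensional ℝ E] [MeasurableSpace E] [BorelSpace E] (μ : Measure E)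
    [μ.IsAddHaarMeasure] (p : Seminorm ℝ E) (hp : Continuous p) {V : ℕ → Submodule ℝ E}
    (hV : Monotone V) {d : ℕ} (hfin : ∀ i ≤ d, Module.finrank ℝ (V i) = i) {l : ℕ → ℝ}
    (hl0 : ∀ i ≤ d, 0 < l i) (hl : ∀ i < d, l i ≤ l (i + 1)) {q : ℕ} (hq : q ≤ d) :
    ∃ A ⊆ {y | p y < l d / 2}, MeasurableSet A ∧
      (∀ i ≤ q, ∀ a ∈ A, ∀ b ∈ A, a - b ∈ V (i + 1) → p (a - b) < l i * l d / l q) ∧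
      ENNReal.ofReal (l q ^ q) * μ A =
        ENNReal.ofReal (∏ i ∈ Finset.range q, l i) * μ {y | p y < l d / 2} := by
  have hopen : IsOpen {y | p y < l d / 2} := isOpen_lt hp continuous_const
  have hconv : Convex ℝ {y | p y < l d / 2} := by
    simpa using p.convexOn.convex_lt (l d / 2)
  have hbody : ∀ a ∈ {y | p y < l d / 2}, ∀ b ∈ {y | p y < l d / 2}, p (a - b) < l d := by
    intro a ha b hb
    have := map_sub_le_add p a b
    simp only [mem_ofPred_eq] at ha hb
    linarith
  induction q with
  | zero =>
    refine ⟨_, subset_rfl, hopen.measurableSet, ?_, by simp⟩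
    intro i hi a ha b hb _
    obtain rfl : i = 0 := by lia
    rw [mul_div_cancel_left₀ _ (hl0 0 (by lia)).ne']
    exact hbody a ha b hb
  | succ q ih =>
    obtain ⟨A, hAK, hA, hAV, hvol⟩ := ih (by lia)
    have hq0 := hl0 q (by lia)
    have hq1 := hl0 (q + 1) hq
    obtain ⟨A', hA'K, hA', hA'v, hA'd⟩ := exists_squeeze μ (V (q + 1)) hopen hconv hA hAK
      (div_pos hq0 hq1) ((div_le_one hq1).2 (hl q (by lia)))
    refine ⟨A', hA'K, hA', ?_, ?_⟩
    · intro i hi a ha b hb hab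
      obtain hi | rfl := Nat.lt_or_eq_of_le hi
      · obtain ⟨a₁, ha₁, b₁, hb₁, h⟩ := hA'd a ha b hb (hV (by lia) hab)
        rw [h] at hab ⊢
        have hlt := hAV i (by lia) a₁ ha₁ b₁ hb₁
          (((V (i + 1)).smul_mem_iff (div_pos hq0 hq1).ne').1 hab)
        rw [map_smul_eq_mul, Real.norm_of_nonneg (div_pos hq0 hq1).le]
        calc l q / l (q + 1) * p (a₁ - b₁) < l q / l (q + 1) * (l i * l d / l q) := by
              gcongr
          _ = _ := by field_simp
      · rw [mul_div_cancel_left₀ _ hq1.ne']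
        exact hbody a (hA'K ha) b (hA'K hb)
    · rw [hA'v, hfin _ hq, ← mul_assoc, ← ENNReal.ofReal_mul (by positivity), ← mul_pow,
        mul_div_cancel₀ _ hq1.ne', pow_succ', ENNReal.ofReal_mul hq0.le, mul_assoc, hvol,
        Finset.prod_range_succ_comm, ENNReal.ofReal_mul hq0.le, mul_assoc]

/-- The upper bound in the **second theorem of Minkowski**, for lower bounds `l i` of a seminorm on the
integral vectors outside the members of a complete flag `V i`. -/
theorem Seminorm.prod_mul_volume_le_one {d : ℕ} (p : Seminorm ℝ (Fin (d + 1) → ℝ))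
    (hp : Continuous p) {V : ℕ → Submodule ℝ (Fin (d + 1) → ℝ)} (hV : Monotone V)
    (hfin : ∀ i ≤ d + 1, Module.finrank ℝ (V i) = i) {l : ℕ → ℝ}
    (hl0 : ∀ i ≤ d, 0 < l i) (hl : ∀ i < d, l i ≤ l (i + 1))
    (hmin : ∀ i ≤ d, ∀ x : Fin (d + 1) → ℤ, (fun j => (x j : ℝ)) ∉ V i →
      l i ≤ p (fun j => (x j : ℝ))) :
    ENNReal.ofReal (∏ i ∈ Finset.range (d + 1), l i) * volume {y | p y < 1 / 2} ≤ 1 := by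
  obtain ⟨A, hAK, hA, hAV, hvol⟩ := p.exists_subset_ball_sub_lt volume hp hV
    (fun i hi => hfin i (by lia)) hl0 hl le_rfl
  have hd := hl0 d le_rfl
  have hbody : volume {y | p y < l d / 2} =
      ENNReal.ofReal (l d ^ (d + 1)) * volume {y | p y < 1 / 2} := by
    have h := Measure.addHaar_preimage_smul (volume : Measure (Fin (d + 1) → ℝ))
      (inv_ne_zero hd.ne') {y | p y < 1 / 2}
    rw [Module.finrank_fin_fun, inv_pow, inv_inv, abs_of_pos (by positivity)] at h
    rw [← h]
    congr 1
    ext y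
    simp only [mem_ofPred_eq, mem_preimage, map_smul_eq_mul, norm_inv, Real.norm_of_nonneg hd.le]
    rw [inv_mul_lt_iff₀ hd, mul_one_div]
  have hA1 : volume A ≤ 1 := by
    by_contra! hlt
    obtain ⟨a, ha, b, hb, x, hx, hab⟩ := exists_sub_eq_intCast hA hlt
    have htop : V (d + 1) = ⊤ := Submodule.eq_top_of_finrank_eq (by simp [hfin])
    have hex : ∃ j, a - b ∈ V j := ⟨d + 1, by simp [htop]⟩
    classical
    obtain ⟨j, hj, hjmin⟩ : ∃ j, a - b ∈ V j ∧ ∀ i < j, a - b ∉ V i :=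
      ⟨Nat.find hex, Nat.find_spec hex, fun i => Nat.find_min hex⟩
    have hjd : j ≤ d + 1 := by
      by_contra! h
      exact hjmin _ h (by simp [htop])
    cases j with
    | zero =>
      have : V 0 = ⊥ := Submodule.finrank_eq_zero.1 (hfin 0 (by lia))
      rw [this, Submodule.mem_bot, hab] at hj
      exact hx (funext fun i => by simpa using congrFun hj i)
    | succ j =>
      have h1 := hAV j (by lia) a ha b hb hj
      have h2 := hmin j (by lia) x (hab ▸ hjmin j (by lia))
      rw [mul_div_cancel_right₀ _ hd.ne', hab] at h1
      exact absurd h2 h1.not_ge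
  rw [hbody, pow_succ', ENNReal.ofReal_mul hd.le] at hvol
  have hc : ENNReal.ofReal (l d ^ d) ≠ 0 := by simpa using pow_pos hd d
  rw [Finset.prod_range_succ, ENNReal.ofReal_mul (Finset.prod_nonneg fun i hi =>
    (hl0 i (by have := Finset.mem_range.1 hi; lia)).le)]
  have : volume A = ENNReal.ofReal (∏ i ∈ Finset.range d, l i) * ENNReal.ofReal (l d) *
      volume {y | p y < 1 / 2} := by
    rw [← ENNReal.mul_right_inj hc ENNReal.ofReal_ne_top, hvol]
    ring
  rwa [← this]

theorem Submodule.exists_intCast_notMem {k : ℕ} {W : Submodule ℝ (Fin k → ℝ)} (hW : W ≠ ⊤) :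
    ∃ x : Fin k → ℤ, (fun j => (x j : ℝ)) ∉ W := by
  by_contra! h
  refine hW (top_unique ?_)
  rw [← (Pi.basisFun ℝ (Fin k)).span_eq, Submodule.span_le]
  rintro _ ⟨i, rfl⟩
  have hi : Pi.basisFun ℝ (Fin k) i = fun j => ((Pi.single i 1 : Fin k → ℤ) j : ℝ) := by
    ext j
    simp [Pi.single_apply]
  exact hi ▸ h (Pi.single i 1)

theorem Seminorm.exists_linearIndependent_prod_mul_volume_le_one {d : ℕ}
    (p : Seminorm ℝ (Fin (d + 1) → ℝ)) (hp : Continuous p) (hpos : ∀ x, x ≠ 0 → 0 < p x)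
    (hint : ∀ x : Fin (d + 1) → ℤ, ∃ N : ℕ, p (fun j => (x j : ℝ)) = N) :
    ∃ v : Fin (d + 1) → Fin (d + 1) → ℤ,
      LinearIndependent ℝ (fun i j => (v i j : ℝ)) ∧
      ENNReal.ofReal (∏ i, p (fun j => (v i j : ℝ))) * volume {y | p y < 1 / 2} ≤ 1 := by
  choose N hN using hint
  have hstep : ∀ W : Submodule ℝ (Fin (d + 1) → ℝ), ∃ x : Fin (d + 1) → ℤ,
      (W ≠ ⊤ → (fun j => (x j : ℝ)) ∉ W) ∧ ∀ y : Fin (d + 1) → ℤ, (fun j => (y j : ℝ)) ∉ W →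
        p (fun j => (x j : ℝ)) ≤ p (fun j => (y j : ℝ)) := by
    intro W
    by_cases hW : W = ⊤
    · exact ⟨0, by simp [hW]⟩
    · obtain ⟨x, hx, hxm⟩ := (measure N).wf.has_min {x | (fun j => (x j : ℝ)) ∉ W}
        (Submodule.exists_intCast_notMem hW)
      refine ⟨x, fun _ => hx, fun y hy => ?_⟩
      rw [hN, hN, Nat.cast_le]
      exact not_lt.1 (hxm y hy)
  choose f hf hfm using hstep
  obtain ⟨V, hV0, hVs⟩ : ∃ V : ℕ → Submodule ℝ (Fin (d + 1) → ℝ), V 0 = ⊥ ∧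
      ∀ i, V (i + 1) = V i ⊔ Submodule.span ℝ {fun j => (f (V i) j : ℝ)} :=
    ⟨fun n => Nat.rec ⊥ (fun _ W => W ⊔ Submodule.span ℝ {fun j => (f W j : ℝ)}) n,
      rfl, fun _ => rfl⟩
  have hV : Monotone V := monotone_nat_of_le_succ fun i => (hVs i) ▸ le_sup_left
  have hne : ∀ W : Submodule ℝ (Fin (d + 1) → ℝ), Module.finrank ℝ W ≤ d → W ≠ ⊤ := by
    rintro _ h rfl
    rw [finrank_top, Module.finrank_fin_fun] at h
    lia
  have hfin : ∀ i ≤ d + 1, Module.finrank ℝ (V i) = i := by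
    intro i hi
    induction i with
    | zero => rw [hV0, finrank_bot]
    | succ i ih =>
      have h := ih (by lia)
      rw [hVs, Submodule.finrank_sup_span_singleton (hf _ (hne _ (by lia))), h]
  have hmem : ∀ i ≤ d, (fun j => (f (V i) j : ℝ)) ∉ V i := fun i hi =>
    hf _ (hne _ ((hfin i (by lia)).trans_le hi))
  refine ⟨fun i => f (V i), ?_, ?_⟩
  · refine linearIndependent_of_top_le_span_of_card_eq_finrank ?_ (by simp)
    have htop : V (d + 1) = ⊤ := Submodule.eq_top_of_finrank_eq (by simp [hfin])
    rw [← htop]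
    have : ∀ i ≤ d + 1, V i ≤
        Submodule.span ℝ (range fun (i : Fin (d + 1)) (j : Fin (d + 1)) => (f (V i) j : ℝ)) := by
      intro i hi
      induction i with
      | zero => exact hV0 ▸ bot_le
      | succ i ih =>
        rw [hVs, sup_le_iff, Submodule.span_singleton_le_iff_mem]
        exact ⟨ih (by lia), Submodule.subset_span ⟨⟨i, hi⟩, rfl⟩⟩
    exact this _ le_rfl
  · rw [Fin.prod_univ_eq_prod_range (fun i => p (fun j => (f (V i) j : ℝ)))]
    refine p.prod_mul_volume_le_one hp hV hfin ?_ ?_ fun i _ => hfm _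
    · intro i hi
      refine hpos _ fun h => hmem i hi ?_
      rw [h]
      exact zero_mem _
    · exact fun i hi => hfm _ _ fun h => hmem (i + 1) hi (hV (Nat.le_succ i) h)

namespace Matrix

theorem gcd_minors_dvd_det_mul {m n : ℕ} (A : Matrix (Fin m) (Fin n) ℤ)
    (U : Matrix (Fin n) (Fin m) ℤ) :
    Finset.univ.gcd (fun g : Fin m → Fin n => (A.submatrix id g).det) ∣ (A * U).det := by
  have h : (A * U).det = ∑ g : Fin m → Fin n, (∏ j, U (g j) j) * (A.submatrix id g).det := by
    have h1 := (detRowAlternating (R := ℤ) (n := Fin m)).toMultilinearMap.map_sum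
      (fun (j : Fin m) (i : Fin n) => U i j • A.transpose i)
    have h2 : (A * U).transpose = of fun j => ∑ i, U i j • A.transpose i := by
      ext j k
      simp [mul_apply, Finset.sum_apply, mul_comm]
    rw [← det_transpose, h2]
    refine h1.trans (Finset.sum_congr rfl fun g _ => ?_)
    rw [MultilinearMap.map_smul_univ, smul_eq_mul, ← det_transpose (A.submatrix id g)]
    rfl
  rw [h]
  exact Finset.dvd_sum fun g hg => (Finset.gcd_dvd hg).mul_left _

theorem det_ne_zero_of_rank_eq {K : Type*} [Field K] {m : ℕ} {A : Matrix (Fin m) (Fin m) K}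
    (h : A.rank = m) : A.det ≠ 0 := by
  rw [← isUnit_iff_ne_zero, ← isUnit_iff_isUnit_det, ← mulVec_surjective_iff_isUnit]
  have htop : A.mulVecLin.range = ⊤ :=
    Submodule.eq_top_of_finrank_eq (by rw [Module.finrank_fin_fun]; exact h)
  exact LinearMap.range_eq_top.1 htop

theorem det_transpose_mul_self_nonneg {m k : Type*} [Fintype m] [Fintype k] [DecidableEq k]
    (M : Matrix m k ℤ) : 0 ≤ (M.transpose * M).det := by
  have h := (posSemidef_conjTranspose_mul_self (M.map (Int.cast : ℤ → ℝ))).det_nonneg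
  rw [conjTranspose_eq_transpose_of_trivial, ← transpose_map] at h
  have h2 := (Int.castRingHom ℝ).map_det (M.transpose * M)
  rw [RingHom.mapMatrix_apply, Matrix.map_mul] at h2
  have : (0 : ℝ) ≤ Int.castRingHom ℝ (M.transpose * M).det := h2 ▸ h
  simpa using this

theorem exists_complement_range {m n r s : ℕ} (A : Matrix (Fin m) (Fin n) ℤ)
    (hr : Module.finrank ℤ A.mulVecLin.range = r) (hs : Module.finrank ℤ A.mulVecLin.ker = s) :
    ∃ (U : Matrix (Fin n) (Fin r) ℤ) (B : Matrix (Fin n) (Fin s) ℤ)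
      (C : Matrix (Fin r) (Fin n) ℤ) (D : Matrix (Fin s) (Fin n) ℤ),
      A * B = 0 ∧ U * C + B * D = 1 := by
  let bR := Module.finBasisOfFinrankEq ℤ A.mulVecLin.range hr
  let bK := Module.finBasisOfFinrankEq ℤ A.mulVecLin.ker hs
  have hu : ∀ j, ∃ u, A.mulVecLin u = bR j := fun j => (bR j).2
  choose u hu using hu
  let c : Fin n → Fin r → ℤ := fun i => bR.repr (A.mulVecLin.rangeRestrict (Pi.single i 1))
  have hc : ∀ i, A.mulVecLin (Pi.single i 1 - ∑ j, c i j • u j) = 0 := by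
    intro i
    have h := congrArg Subtype.val
      (bR.sum_repr (A.mulVecLin.rangeRestrict (Pi.single i 1)))
    simp only [Submodule.coe_sum, Submodule.coe_smul, LinearMap.codRestrict_apply, LinearMap.rangeRestrict] at h
    simp only [map_sub, map_sum, map_smul, hu]
    rw [← h, sub_eq_zero]
  let d : Fin n → Fin s → ℤ := fun i => bK.repr ⟨_, hc i⟩
  refine ⟨of fun i j => u j i, of fun i j => (bK j : Fin n → ℤ) i, of fun j i => c i j,
    of fun j i => d i j, ?_, ?_⟩
  · ext i j
    exact congrFun (bK j).2 i
  · ext i j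
    have h := congrArg Subtype.val (bK.sum_repr ⟨_, hc j⟩)
    have h2 := congrFun h i
    simp only [Submodule.coe_sum, Submodule.coe_smul, Finset.sum_apply, Pi.smul_apply,
      Pi.sub_apply, smul_eq_mul] at h2
    simp only [add_apply, mul_apply, of_apply, one_apply, d]
    rw [Pi.single_apply] at h2
    simp only [mul_comm (u _ _), mul_comm ((bK _ : Fin n → ℤ) i)]
    rw [h2]
    ring

theorem det_mul_transpose_mul_det_transpose_mul {R m n s : Type*} [CommRing R] [Fintype m]
    [Fintype n] [Fintype s] [DecidableEq m] [DecidableEq n] [DecidableEq s] (e : n ≃ m ⊕ s)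
    {A : Matrix m n R} {U : Matrix n m R} {B : Matrix n s R} {C : Matrix m n R}
    {D : Matrix s n R} (hAB : A * B = 0) (h : U * C + B * D = 1) :
    (A * A.transpose).det * (B.transpose * B).det =
      (C * A.transpose).det ^ 2 * ((fromCols U B).transpose * fromCols U B).det := by
  rw [← fromCols_mul_fromRows] at h
  have h' := (mul_eq_one_comm_of_equiv e).1 h
  rw [fromRows_mul_fromCols, ← fromBlocks_one, fromBlocks_inj] at h'
  obtain ⟨-, hCB, -, hDB⟩ := h'
  have h1 : (fromCols A.transpose B).transpose * fromCols A.transpose B =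
      fromBlocks (A * A.transpose) 0 0 (B.transpose * B) := by
    rw [transpose_fromCols, fromRows_mul_fromCols, transpose_transpose, hAB, ← transpose_mul,
      hAB, transpose_zero]
  have h2 : fromRows C D * fromCols A.transpose B =
      fromBlocks (C * A.transpose) 0 (D * A.transpose) 1 := by
    rw [fromRows_mul_fromCols, hCB, hDB]
  have h3 : fromCols A.transpose B =
      fromCols U B * fromBlocks (C * A.transpose) 0 (D * A.transpose) 1 := by
    rw [← h2, ← Matrix.mul_assoc, h, Matrix.one_mul]
  have h4 := congrArg det h1
  rw [det_fromBlocks_zero₁₂] at h4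
  rw [← h4, h3, transpose_mul, Matrix.mul_assoc, ← Matrix.mul_assoc (fromCols U B).transpose,
    det_mul, det_mul, det_transpose, det_fromBlocks_zero₁₂, det_one]
  ring

theorem det_transpose_mul_self_eq_one {n k : Type*} [Fintype n] [Fintype k] [DecidableEq n]
    [DecidableEq k] (e : n ≃ k) {U : Matrix n k ℤ} {V : Matrix k n ℤ} (h : U * V = 1) :
    (U.transpose * U).det = 1 := by
  have h1 : (U.transpose * U) * (V * V.transpose) = 1 := by
    rw [Matrix.mul_assoc, ← Matrix.mul_assoc U, h, Matrix.one_mul, ← transpose_mul,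
      (mul_eq_one_comm_of_equiv e).1 h, transpose_one]
  have h2 : IsUnit (U.transpose * U).det :=
    IsUnit.of_mul_eq_one (V * V.transpose).det (by rw [← det_mul, h1, det_one])
  have h3 := det_transpose_mul_self_nonneg U
  rcases Int.isUnit_iff.1 h2 with h2 | h2 <;> lia

theorem finrank_range_mulVecLin_of_rank_map {m n : ℕ} (A : Matrix (Fin m) (Fin n) ℤ)
    (hrank : (A.map (Int.cast : ℤ → ℝ)).rank = m) :
    Module.finrank ℤ A.mulVecLin.range = m := by
  apply le_antisymm
  · simpa using Submodule.finrank_le A.mulVecLin.range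
  · obtain ⟨U, B, C, D, hAB, h⟩ := A.exists_complement_range rfl rfl
    have hA : A = (A * U) * C := by
      rw [Matrix.mul_assoc, eq_sub_of_add_eq h, Matrix.mul_sub, ← Matrix.mul_assoc, hAB]
      simp
    have hA' : A.map (Int.cast : ℤ → ℝ) =
        (A * U).map (Int.cast : ℤ → ℝ) * C.map (Int.cast : ℤ → ℝ) := by
      conv_lhs => rw [hA]
      exact Matrix.map_mul (f := Int.castRingHom ℝ)
    refine hrank.ge.trans ?_
    rw [hA']
    exact (rank_mul_le_left _ _).trans (rank_le_width _)

theorem exists_mul_eq_zero_det_transpose_mul_self {m n : ℕ} (hmn : m ≤ n)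
    (A : Matrix (Fin m) (Fin n) ℤ) (hrank : (A.map (Int.cast : ℤ → ℝ)).rank = m) :
    ∃ (B : Matrix (Fin n) (Fin (n - m)) ℤ) (h : ℤ), A * B = 0 ∧ h ≠ 0 ∧
      Finset.univ.gcd (fun g : Fin m → Fin n => (A.submatrix id g).det) ∣ h ∧
      (A * A.transpose).det = h ^ 2 * (B.transpose * B).det ∧ 0 < (B.transpose * B).det := by
  have hr := A.finrank_range_mulVecLin_of_rank_map hrank
  have hs : Module.finrank ℤ A.mulVecLin.ker = n - m := by
    have := Submodule.finrank_quotient_add_finrank A.mulVecLin.ker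
    rw [A.mulVecLin.quotKerEquivRange.finrank_eq, hr, Module.finrank_fin_fun] at this
    lia
  obtain ⟨U, B, C, D, hAB, h⟩ := A.exists_complement_range hr hs
  have hA : A = (A * U) * C := by
    rw [Matrix.mul_assoc, eq_sub_of_add_eq h, Matrix.mul_sub, ← Matrix.mul_assoc, hAB]
    simp
  have hdet : (A * A.transpose).det ≠ 0 := by
    have h1 := det_ne_zero_of_rank_eq ((rank_self_mul_transpose _).trans hrank)
    rw [← transpose_map] at h1
    have h2 := (Int.castRingHom ℝ).map_det (A * A.transpose)
    rw [RingHom.mapMatrix_apply, Matrix.map_mul] at h2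
    intro h0
    rw [h0, map_zero] at h2
    exact h1 h2.symm
  let e : Fin n ≃ Fin m ⊕ Fin (n - m) := (finCongr (by lia)).trans finSumFinEquiv.symm
  have h1 := det_mul_transpose_mul_det_transpose_mul e hAB h
  rw [det_transpose_mul_self_eq_one e ((fromCols_mul_fromRows _ _ _ _).trans h), mul_one] at h1
  have h2 : (A * A.transpose).det = (A * U).det * (C * A.transpose).det := by
    rw [← det_mul, ← Matrix.mul_assoc, ← hA]
  have hU : (A * U).det ≠ 0 := fun h0 => hdet (by rw [h2, h0, zero_mul])
  have hC : (C * A.transpose).det ≠ 0 := fun h0 => hdet (by rw [h2, h0, mul_zero])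
  have h3 : (A * U).det * (B.transpose * B).det = (C * A.transpose).det := by
    apply mul_right_cancel₀ hC
    rw [h2] at h1
    linear_combination h1
  have hfin : (A * A.transpose).det = (A * U).det ^ 2 * (B.transpose * B).det := by
    rw [h2, ← h3]
    ring
  refine ⟨B, (A * U).det, hAB, hU, A.gcd_minors_dvd_det_mul U, hfin,
    (det_transpose_mul_self_nonneg B).lt_of_ne fun h0 => hdet ?_⟩
  rw [hfin, ← h0, mul_zero]

end Matrix

theorem norm_intCast_pi_eq_natCast {ι : Type*} [Fintype ι] (x : ι → ℤ) :
    ‖(fun i => (x i : ℝ))‖ = ((Finset.univ.sup fun i => (x i).natAbs : ℕ) : ℝ) := by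
  have hx : ∀ i, ‖(x i : ℝ)‖ = ((x i).natAbs : ℝ) := fun i => by
    rw [Real.norm_eq_abs, Nat.cast_natAbs, Int.cast_abs]
  apply le_antisymm
  · rw [pi_norm_le_iff_of_nonneg (Nat.cast_nonneg _)]
    intro i
    rw [hx, Nat.cast_le]
    exact Finset.le_sup (f := fun i => (x i).natAbs) (Finset.mem_univ i)
  · rw [← Nat.le_floor_iff (norm_nonneg _)]
    refine Finset.sup_le fun i _ => ?_
    rw [Nat.le_floor_iff (norm_nonneg _), ← hx]
    exact norm_le_pi_norm (fun i => (x i : ℝ)) i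

theorem Matrix.exists_linearIndependent_prod_norm_mulVec_le {n k : ℕ} (hk : 0 < k)
    (B : Matrix (Fin n) (Fin k) ℤ) (hB : 0 < (B.transpose * B).det) :
    ∃ v : Fin k → Fin k → ℤ, LinearIndependent ℤ (fun j => B.mulVec (v j)) ∧
      ∏ j, ‖(fun i => (B.mulVec (v j) i : ℝ))‖ ≤ √((B.transpose * B).det : ℝ) := by
  obtain ⟨d, rfl⟩ := Nat.exists_eq_add_one.2 hk
  let R : Matrix (Fin n) (Fin (d + 1)) ℝ := B.map Int.cast
  have hR : (R.transpose * R).det = ((B.transpose * B).det : ℝ) := by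
    have h := (Int.castRingHom ℝ).map_det (B.transpose * B)
    rw [RingHom.mapMatrix_apply, Matrix.map_mul] at h
    exact h.symm
  have hpos : 0 < (R.transpose * R).det := hR ▸ Int.cast_pos.2 hB
  have hinj : ∀ y, R.mulVec y = 0 → y = 0 := fun y hy =>
    Matrix.eq_zero_of_mulVec_eq_zero hpos.ne' (by rw [← Matrix.mulVec_mulVec, hy, mulVec_zero])
  have hcast : ∀ x : Fin (d + 1) → ℤ,
      R.mulVec (fun j => (x j : ℝ)) = fun i => (B.mulVec x i : ℝ) := fun x => by
    ext i
    simp [R, mulVec, dotProduct]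
  let p : Seminorm ℝ (Fin (d + 1) → ℝ) := (normSeminorm ℝ (Fin n → ℝ)).comp R.mulVecLin
  have hp : ∀ y, p y = ‖R.mulVec y‖ := fun _ => rfl
  obtain ⟨v, hv, hle⟩ := p.exists_linearIndependent_prod_mul_volume_le_one
    (continuous_norm.comp R.mulVecLin.continuous_of_finiteDimensional)
    (fun x hx => norm_pos_iff.2 fun h => hx (hinj x h))
    (fun x => ⟨_, by rw [hp, hcast, norm_intCast_pi_eq_natCast]⟩)
  refine ⟨v, ?_, ?_⟩
  · have h1 : LinearIndependent ℝ (fun j => R.mulVecLin fun i => (v j i : ℝ)) :=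
      hv.map' R.mulVecLin (LinearMap.ker_eq_bot'.2 hinj)
    have h2 : LinearIndependent ℤ (fun j => R.mulVecLin fun i => (v j i : ℝ)) :=
      h1.restrict_scalars' ℤ
    refine LinearIndependent.of_comp
      ((Int.castAddHom ℝ).compLeft (Fin n)).toIntLinearMap ?_
    have h3 : (fun j => R.mulVecLin fun i => (v j i : ℝ)) =
        fun j i => (B.mulVec (v j) i : ℝ) := funext fun j => hcast (v j)
    rw [h3] at h2
    exact h2
  · have hvol := inv_sqrt_det_le_volume_section R hpos.ne'
    have hset : {y : Fin (d + 1) → ℝ | ∀ i, R i ⬝ᵥ y ∈ Ioo (-1 / 2 : ℝ) (1 / 2)} =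
        {y | p y < 1 / 2} := by
      ext y
      simp only [mem_ofPred_eq]
      rw [hp, pi_norm_lt_iff (by norm_num)]
      refine forall_congr' fun i => ?_
      rw [Real.norm_eq_abs, abs_lt, neg_div]
      rfl
    rw [hset] at hvol
    have h := (mul_le_mul_right hvol _).trans hle
    rw [← ENNReal.ofReal_mul (Finset.prod_nonneg fun i _ => apply_nonneg p _),
      ENNReal.ofReal_le_one, ← div_eq_mul_inv, div_le_one (Real.sqrt_pos.2 hpos), hR] at h
    simpa only [hp, hcast] using h

end

/-- Bombieri–Vaaler Siegel's lemma: For an integral `m × n`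
matrix `A` of rank `m < n`, the system `Ax = 0` has `n - m` linearly
independent integral solutions `x₁, …, x_{n-m}` with
`∏ ‖x_i‖_∞ ≤ √(det (AAᵀ)) / gcd(A)`, where `gcd(A)` is the gcd of all
`m × m` subdeterminants of `A`. -/
theorem stmt_5 (m n : ℕ) (hmn : m < n) (A : Matrix (Fin m) (Fin n) ℤ)
    (hrank : (A.map (Int.cast : ℤ → ℝ)).rank = m) :
    ∃ x : Fin (n - m) → (Fin n → ℤ), LinearIndependent ℤ x ∧
      (∀ k, A.mulVec (x k) = 0) ∧
      (∏ k, ‖(fun i => (x k i : ℝ) : Fin n → ℝ)‖) ≤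
        Real.sqrt (((A * A.transpose).det : ℤ) : ℝ) /
          ((Finset.univ.gcd (fun g : Fin m → Fin n => (A.submatrix id g).det) : ℤ) : ℝ) := by
  obtain ⟨B, h, hAB, hh, hgcd, hdet, hpos⟩ :=
    A.exists_mul_eq_zero_det_transpose_mul_self hmn.le hrank
  obtain ⟨v, hv, hle⟩ := B.exists_linearIndependent_prod_norm_mulVec_le (by lia) hpos
  refine ⟨fun k => B.mulVec (v k), hv, fun k => by simp [Matrix.mulVec_mulVec, hAB], ?_⟩
  have hg := Finset.normalize_gcd (s := Finset.univ)
    (f := fun g : Fin m → Fin n => (A.submatrix id g).det)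
  generalize Finset.univ.gcd (fun g : Fin m → Fin n => (A.submatrix id g).det) = c at *
  have hc0 : c ≠ 0 := fun h0 => hh (zero_dvd_iff.1 (h0 ▸ hgcd))
  have hc : 0 < c := lt_of_le_of_ne (Int.nonneg_iff_normalize_eq_self c |>.1 hg) hc0.symm
  have hch : (c : ℝ) ≤ |(h : ℝ)| := by
    rw [← Int.cast_abs, Int.cast_le]
    exact Int.le_of_dvd (abs_pos.2 hh) ((dvd_abs _ _).2 hgcd)
  rw [le_div_iff₀ (Int.cast_pos.2 hc), hdet, Int.cast_mul, Int.cast_pow,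
    Real.sqrt_mul (sq_nonneg _), Real.sqrt_sq_eq_abs, mul_comm]
  gcongr
end

section
/- Let A ∈ ℤ^{m×n}, m < n, be an integral matrix of rank m, and let ‖A‖_∞ = max_{i,j} |a_{ij}|. Then the system Ax = 0 has a solution x ∈ ℤⁿ with 0 < ‖x‖_∞ < 1 + (n‖A‖_∞)^{m/(n-m)}. -/
/-- The entrywise sup norm of an integer matrix is at most the natural-number supremum of the
absolute values of its entries. -/
theorem Int.Matrix.norm_le_sup_natAbs {α β : Type*} [Fintype α] [Fintype β] (A : Matrix α β ℤ) :
    @norm _ Matrix.seminormedAddCommGroup.toNorm A ≤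
      ((Finset.univ.sup (fun p : α × β => (A p.1 p.2).natAbs) : ℕ) : ℝ) := by
  let _ := Matrix.seminormedAddCommGroup (m := α) (n := β) (α := ℤ)
  refine (Matrix.norm_le_iff (Nat.cast_nonneg _)).2 fun i j => ?_
  rw [Int.norm_eq_abs, ← Int.cast_abs, ← Nat.cast_natAbs]
  exact_mod_cast Finset.le_sup (f := fun p : α × β => (A p.1 p.2).natAbs) (Finset.mem_univ (i, j))

/-- Siegel's lemma: For an integral `m × n` matrix `A` of rank
`m < n`, the system `Ax = 0` has an integral solution `x` with
`0 < ‖x‖_∞ < 1 + (n ‖A‖_∞)^{m/(n-m)}`, where `‖A‖_∞ = max |a_{ij}|`. -/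
theorem stmt_6 (m n : ℕ) (hmn : m < n) (A : Matrix (Fin m) (Fin n) ℤ)
    (hrank : (A.map (Int.cast : ℤ → ℝ)).rank = m) :
    ∃ x : Fin n → ℤ, A.mulVec x = 0 ∧
      0 < ‖(fun i => (x i : ℝ) : Fin n → ℝ)‖ ∧
      ‖(fun i => (x i : ℝ) : Fin n → ℝ)‖ <
        1 + ((n : ℝ) *
            ((Finset.univ.sup (fun p : Fin m × Fin n => (A p.1 p.2).natAbs) : ℕ) : ℝ)) ^
          ((m : ℝ) / ((n : ℝ) - (m : ℝ))) := by
  have norm_cast_eq (x : Fin n → ℤ) : ‖(fun i => (x i : ℝ) : Fin n → ℝ)‖ = ‖x‖ := by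
    simp only [Pi.norm_def, nnnorm, Int.norm_cast_real]
  simp only [norm_cast_eq]
  have hsub : (0 : ℝ) < n - m := sub_pos.2 (mod_cast hmn)
  rcases Nat.eq_zero_or_pos m with rfl | hm
  · have : Nonempty (Fin n) := ⟨⟨0, hmn⟩⟩
    refine ⟨fun _ => 1, Subsingleton.elim _ _, ?_, ?_⟩ <;> simp
  · have hA : A ≠ 0 := by
      rintro rfl
      rw [Matrix.map_zero _ Int.cast_zero, Matrix.rank_zero] at hrank
      exact hm.ne hrank
    obtain ⟨x, hx, hAx, hle⟩ := Int.Matrix.exists_ne_zero_int_vec_norm_le' A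
      (by simpa using hmn) (by simpa using hm) hA
    simp only [Fintype.card_fin] at hle
    refine ⟨x, hAx, norm_pos_iff.2 hx, (hle.trans ?_).trans_lt (lt_one_add _)⟩
    let _ := Matrix.seminormedAddCommGroup (m := Fin m) (n := Fin n) (α := ℤ)
    gcongr
    exact Int.Matrix.norm_le_sup_natAbs A
end
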